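/- λμx implements λμ-reduction: (1) if M →βμ N (in λμ) then M →*x N (in λμx); (2) if M is a pure λμ-term (without explicit substitutions) and M →x N, then there exists a pure λμ-term L such that N →*xsub L. -/

import Mathlib

set_option autoImplicit true
set_option maxHeartbeats 1000000

namespace PiLMu

/-- Terms of the λμx-calculus: variables, abstraction, application,
    context switch μα.[β]M, explicit term substitution M⟨x:=N⟩,
    explicit structural substitution M⟨α:=N·γ⟩, and ⊥ (for weak approximants). -/
inductive Trm : Type
  | var : ℕ → Trm
  | lam : ℕ → Trm → Trm
  | app : Trm → Trm → Trm
  | mu  : ℕ → ℕ → Trm → Trm            -- mu α β M  ≙  μα.[β]M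
  | tsub : Trm → ℕ → Trm → Trm         -- M⟨x:=N⟩
  | csub : Trm → ℕ → Trm → ℕ → Trm     -- M⟨α:=N·γ⟩
  | bot : Trm
  deriving DecidableEq

namespace Trm

/-- free term variables -/
def fv : Trm → Finset ℕ
  | var x => {x}
  | lam x M => fv M \ {x}
  | app M N => fv M ∪ fv N
  | mu _ _ M => fv M
  | tsub M x N => (fv M \ {x}) ∪ fv N
  | csub M _ N _ => fv M ∪ fv N
  | bot => ∅

/-- free names -/
def fn : Trm → Finset ℕ
  | var _ => ∅
  | lam _ M => fn M
  | app M N => fn M ∪ fn N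
  | mu α β M => (fn M ∪ {β}) \ {α}
  | tsub M _ N => fn M ∪ fn N
  | csub M α N γ => ((fn M) \ {α}) ∪ fn N ∪ {γ}
  | bot => ∅

/-- (capture-naive) term substitution M[N/x] -/
def subst : Trm → ℕ → Trm → Trm
  | var y, x, N => if y = x then N else var y
  | lam y M, x, N => if y = x then lam y M else lam y (subst M x N)
  | app P Q, x, N => app (subst P x N) (subst Q x N)
  | mu α β M, x, N => mu α β (subst M x N)
  | tsub M y P, x, N =>
      if y = x then tsub M y (subst P x N) else tsub (subst M x N) y (subst P x N)
  | csub M α P γ, x, N => csub (subst M x N) α (subst P x N) γ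
  | bot, _, _ => bot

/-- renaming of a free name:  renN M o n  ≙  M[n/o] -/
def renN : Trm → ℕ → ℕ → Trm
  | var x, _, _ => var x
  | lam x M, o, n => lam x (renN M o n)
  | app P Q, o, n => app (renN P o n) (renN Q o n)
  | mu α β M, o, n =>
      if α = o then mu α β M else mu α (if β = o then n else β) (renN M o n)
  | tsub M x P, o, n => tsub (renN M o n) x (renN P o n)
  | csub M α P γ, o, n =>
      if α = o then csub M α (renN P o n) (if γ = o then n else γ)
      else csub (renN M o n) α (renN P o n) (if γ = o then n else γ)
  | bot, _, _ => bot

/-- implicit structural substitution:  ssub M α N γ  ≙  M[N·γ/α],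
    replacing each named subterm [α]M' by [γ](M'[N·γ/α])N. -/
def ssub : Trm → ℕ → Trm → ℕ → Trm
  | var x, _, _, _ => var x
  | lam x M, α, N, γ => lam x (ssub M α N γ)
  | app P Q, α, N, γ => app (ssub P α N γ) (ssub Q α N γ)
  | mu δ β M, α, N, γ =>
      if δ = α then mu δ β M
      else if β = α then mu δ γ (app (ssub M α N γ) N)
      else mu δ β (ssub M α N γ)
  | tsub M x P, α, N, γ => tsub (ssub M α N γ) x (ssub P α N γ)
  | csub M δ P ε, α, N, γ =>
      if δ = α then csub M δ (ssub P α N γ) ε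
      else csub (ssub M α N γ) δ (ssub P α N γ) ε
  | bot, _, _, _ => bot

def size : Trm → ℕ
  | var _ => 1
  | lam _ M => size M + 1
  | app P Q => size P + size Q + 1
  | mu _ _ M => size M + 1
  | tsub M _ N => size M + size N + 1
  | csub M _ N _ => size M + size N + 1
  | bot => 1

theorem size_renN : ∀ (M : Trm) (o n : ℕ), size (renN M o n) = size M
  | .var x, o, n => by simp [renN, size]
  | .lam x M, o, n => by simp [renN, size, size_renN M o n]
  | .app P Q, o, n => by simp [renN, size, size_renN P o n, size_renN Q o n]
  | .mu α β M, o, n => by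
      by_cases h : α = o <;> simp [renN, size, h, size_renN M o n]
  | .tsub M x P, o, n => by simp [renN, size, size_renN M o n, size_renN P o n]
  | .csub M α P γ, o, n => by
      by_cases h : α = o <;> simp [renN, size, h, size_renN M o n, size_renN P o n]
  | .bot, o, n => by simp [renN, size]

/-- head variable (partial) -/
def hv : Trm → Option ℕ
  | var x => some x
  | lam _ M => hv M
  | app M _ => hv M
  | mu _ _ M => hv M
  | tsub M x _ => if hv M = some x then none else hv M
  | csub M _ _ _ => hv M
  | bot => none

/-- head name (partial) -/
def hn : Trm → Option ℕ
  | mu _ β _ => some β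
  | tsub M _ _ => hn M
  | csub M α _ _ => if hn M = some α then none else hn M
  | _ => none

end Trm

open Trm

/-- pure λμ-terms: no explicit substitutions, no ⊥ -/
inductive Pure : Trm → Prop
  | var : Pure (.var x)
  | lam : Pure M → Pure (.lam x M)
  | app : Pure M → Pure N → Pure (.app M N)
  | mu : Pure M → Pure (.mu α β M)

/-- the contractum of the structural (μ)-rule, with implicit substitution:
    (μα.[β]M)N → μγ.(([β]M)[N·γ/α]) -/
def muApp (α β : ℕ) (M N : Trm) (γ : ℕ) : Trm :=
  if β = α then .mu γ γ (.app (ssub M α N γ) N) else .mu γ β (ssub M α N γ)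

/-- the contractum of the structural (μ)-rule, with explicit substitution:
    (μα.[β]M)N → μγ.(([β]M)⟨α:=N·γ⟩) -/
def muX (α β γ : ℕ) (M N : Trm) : Trm :=
  if β = α then .mu γ γ (.app (.csub M α N γ) N) else .mu γ β (.csub M α N γ)

/-- →βμ: λμ-reduction -/
inductive RedBM : Trm → Trm → Prop
  | beta : RedBM (.app (.lam x M) N) (subst M x N)
  | mu_main : γ ∉ fn M → γ ∉ fn N → γ ≠ α → γ ≠ β →
      RedBM (.app (.mu α β M) N) (muApp α β M N γ)
  | ren : RedBM (.mu δ β (.mu γ α M)) (.mu δ (if α = γ then β else α) (renN M γ β))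
  | erase : α ∉ fn M → RedBM (.mu α α M) M
  | appL : RedBM M M' → RedBM (.app M N) (.app M' N)
  | appR : RedBM N N' → RedBM (.app M N) (.app M N')
  | lam : RedBM M M' → RedBM (.lam x M) (.lam x M')
  | mu : RedBM M M' → RedBM (.mu α β M) (.mu α β M')

/-- →h: head reduction (no reduction in right-hand sides of applications) -/
inductive RedH : Trm → Trm → Prop
  | beta : RedH (.app (.lam x M) N) (subst M x N)
  | mu_main : γ ∉ fn M → γ ∉ fn N → γ ≠ α → γ ≠ β →
      RedH (.app (.mu α β M) N) (muApp α β M N γ)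
  | ren : RedH (.mu δ β (.mu γ α M)) (.mu δ (if α = γ then β else α) (renN M γ β))
  | erase : α ∉ fn M → RedH (.mu α α M) M
  | appL : RedH M M' → RedH (.app M N) (.app M' N)
  | lam : RedH M M' → RedH (.lam x M) (.lam x M')
  | mu : RedH M M' → RedH (.mu α β M) (.mu α β M')

/-- →wh: weak head reduction (furthermore no reduction under λ) -/
inductive RedWH : Trm → Trm → Prop
  | beta : RedWH (.app (.lam x M) N) (subst M x N)
  | mu_main : γ ∉ fn M → γ ∉ fn N → γ ≠ α → γ ≠ β →
      RedWH (.app (.mu α β M) N) (muApp α β M N γ)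
  | ren : RedWH (.mu δ β (.mu γ α M)) (.mu δ (if α = γ then β else α) (renN M γ β))
  | erase : α ∉ fn M → RedWH (.mu α α M) M
  | appL : RedWH M M' → RedWH (.app M N) (.app M' N)
  | mu : RedWH M M' → RedWH (.mu α β M) (.mu α β M')

/-- →x: reduction of λμx -/
inductive RedX : Trm → Trm → Prop
  -- main rules
  | beta : RedX (.app (.lam x M) N) (.tsub M x N)
  | mu_main : γ ∉ fn M → γ ∉ fn N → γ ≠ α → γ ≠ β →
      RedX (.app (.mu α β M) N) (muX α β γ M N)
  | erase : β ∉ fn M → RedX (.mu β β M) M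
  | ren : RedX (.mu δ β (.mu γ α M)) (.mu δ (if α = γ then β else α) (renN M γ β))
  -- term substitution rules
  | tvar : RedX (.tsub (.var x) x N) N
  | tgc : x ∉ fv M → RedX (.tsub M x N) M
  | tlam : y ≠ x → RedX (.tsub (.lam y M) x N) (.lam y (.tsub M x N))
  | tapp : RedX (.tsub (.app P Q) x N) (.app (.tsub P x N) (.tsub Q x N))
  | tmu : RedX (.tsub (.mu α β M) x N) (.mu α β (.tsub M x N))
  -- structural rules
  | cmu : δ ≠ α → RedX (.csub (.mu δ α M) α N γ) (.mu δ γ (.app (.csub M α N γ) N))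
  | cmu' : δ ≠ α → β ≠ α → RedX (.csub (.mu δ β M) α N γ) (.mu δ β (.csub M α N γ))
  | cgc : α ∉ fn M → RedX (.csub M α N γ) M
  | clam : RedX (.csub (.lam x M) α N γ) (.lam x (.csub M α N γ))
  | capp : RedX (.csub (.app P Q) α N γ) (.app (.csub P α N γ) (.csub Q α N γ))
  -- contextual rules
  | appL : RedX M M' → RedX (.app M N) (.app M' N)
  | appR : RedX N N' → RedX (.app M N) (.app M N')
  | lam : RedX M M' → RedX (.lam x M) (.lam x M')
  | mu : RedX M M' → RedX (.mu α β M) (.mu α β M')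
  | tsubL : RedX M M' → RedX (.tsub M x N) (.tsub M' x N)
  | tsubR : RedX N N' → RedX (.tsub M x N) (.tsub M x N')
  | csubL : RedX M M' → RedX (.csub M α N γ) (.csub M' α N γ)
  | csubR : RedX N N' → RedX (.csub M α N γ) (.csub M α N' γ)

/-- →xsub: only the term-substitution and structural rules of →x -/
inductive RedXSub : Trm → Trm → Prop
  | tvar : RedXSub (.tsub (.var x) x N) N
  | tgc : x ∉ fv M → RedXSub (.tsub M x N) M
  | tlam : y ≠ x → RedXSub (.tsub (.lam y M) x N) (.lam y (.tsub M x N))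
  | tapp : RedXSub (.tsub (.app P Q) x N) (.app (.tsub P x N) (.tsub Q x N))
  | tmu : RedXSub (.tsub (.mu α β M) x N) (.mu α β (.tsub M x N))
  | cmu : δ ≠ α → RedXSub (.csub (.mu δ α M) α N γ) (.mu δ γ (.app (.csub M α N γ) N))
  | cmu' : δ ≠ α → β ≠ α → RedXSub (.csub (.mu δ β M) α N γ) (.mu δ β (.csub M α N γ))
  | cgc : α ∉ fn M → RedXSub (.csub M α N γ) M
  | clam : RedXSub (.csub (.lam x M) α N γ) (.lam x (.csub M α N γ))
  | capp : RedXSub (.csub (.app P Q) α N γ) (.app (.csub P α N γ) (.csub Q α N γ))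
  | appL : RedXSub M M' → RedXSub (.app M N) (.app M' N)
  | appR : RedXSub N N' → RedXSub (.app M N) (.app M N')
  | lam : RedXSub M M' → RedXSub (.lam x M) (.lam x M')
  | mu : RedXSub M M' → RedXSub (.mu α β M) (.mu α β M')
  | tsubL : RedXSub M M' → RedXSub (.tsub M x N) (.tsub M' x N)
  | tsubR : RedXSub N N' → RedXSub (.tsub M x N) (.tsub M x N')
  | csubL : RedXSub M M' → RedXSub (.csub M α N γ) (.csub M' α N γ)
  | csubR : RedXSub N N' → RedXSub (.csub M α N γ) (.csub M α N' γ)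

/-- →xh: explicit head reduction -/
inductive RedXH : Trm → Trm → Prop
  -- main rules
  | beta : RedXH (.app (.lam x M) N) (.tsub M x N)
  | mu_main : γ ∉ fn M → γ ∉ fn N → γ ≠ α → γ ≠ β →
      RedXH (.app (.mu α β M) N) (muX α β γ M N)
  | erase : β ∉ fn M → RedXH (.mu β β M) M
  | ren : RedXH (.mu δ β (.mu γ α M)) (.mu δ (if α = γ then β else α) (renN M γ β))
  -- term substitution rules (only towards the head variable)
  | tvar : RedXH (.tsub (.var x) x N) N
  | tgc : x ∉ fv M → RedXH (.tsub M x N) M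
  | tlam : hv (.lam y M) = some x →
      RedXH (.tsub (.lam y M) x N) (.lam y (.tsub M x N))
  | tapp : hv (.app P Q) = some x →
      RedXH (.tsub (.app P Q) x N) (.tsub (.app (.tsub P x N) Q) x N)
  | tmu : hv (.mu α β M) = some x →
      RedXH (.tsub (.mu α β M) x N) (.mu α β (.tsub M x N))
  -- the only two structural rules
  | cmu : δ ≠ α → RedXH (.csub (.mu δ α M) α N γ) (.mu δ γ (.app (.csub M α N γ) N))
  | cgc : α ∉ fn M → RedXH (.csub M α N γ) M
  -- jump rules for stacked substitutions
  | jump_tt : hv M = some y →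
      RedXH (.tsub (.tsub M x N) y L) (.tsub (.tsub (.tsub M y L) x N) y L)
  | jump_tc : hv M = some y →
      RedXH (.tsub (.csub M α N β) y L) (.tsub (.csub (.tsub M y L) α N β) y L)
  | jump_cc : hn M = some β →
      RedXH (.csub (.csub M α N γ) β L δ) (.csub (.csub (.csub M β L δ) α N γ) β L δ)
  | jump_ct : hn M = some β →
      RedXH (.csub (.tsub M x N) β L δ) (.csub (.tsub (.csub M β L δ) x N) β L δ)
  -- contextual rules (no reduction in argument or substitution bodies)
  | appL : RedXH M M' → RedXH (.app M N) (.app M' N)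
  | lam : RedXH M M' → RedXH (.lam x M) (.lam x M')
  | mu : RedXH M M' → RedXH (.mu α β M) (.mu α β M')
  | tsubL : RedXH M M' → RedXH (.tsub M x N) (.tsub M' x N)
  | csubL : RedXH M M' → RedXH (.csub M α N γ) (.csub M' α N γ)

/-- →wxh: weak explicit head reduction (no reduction under λ,
    no pushing of substitutions under λ) -/
inductive RedWXH : Trm → Trm → Prop
  | beta : RedWXH (.app (.lam x M) N) (.tsub M x N)
  | mu_main : γ ∉ fn M → γ ∉ fn N → γ ≠ α → γ ≠ β →
      RedWXH (.app (.mu α β M) N) (muX α β γ M N)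
  | erase : β ∉ fn M → RedWXH (.mu β β M) M
  | ren : RedWXH (.mu δ β (.mu γ α M)) (.mu δ (if α = γ then β else α) (renN M γ β))
  | tvar : RedWXH (.tsub (.var x) x N) N
  | tgc : x ∉ fv M → RedWXH (.tsub M x N) M
  | tapp : hv (.app P Q) = some x →
      RedWXH (.tsub (.app P Q) x N) (.tsub (.app (.tsub P x N) Q) x N)
  | tmu : hv (.mu α β M) = some x →
      RedWXH (.tsub (.mu α β M) x N) (.mu α β (.tsub M x N))
  | cmu : δ ≠ α → RedWXH (.csub (.mu δ α M) α N γ) (.mu δ γ (.app (.csub M α N γ) N))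
  | cgc : α ∉ fn M → RedWXH (.csub M α N γ) M
  | jump_tt : hv M = some y →
      RedWXH (.tsub (.tsub M x N) y L) (.tsub (.tsub (.tsub M y L) x N) y L)
  | jump_tc : hv M = some y →
      RedWXH (.tsub (.csub M α N β) y L) (.tsub (.csub (.tsub M y L) α N β) y L)
  | jump_cc : hn M = some β →
      RedWXH (.csub (.csub M α N γ) β L δ) (.csub (.csub (.csub M β L δ) α N γ) β L δ)
  | jump_ct : hn M = some β →
      RedWXH (.csub (.tsub M x N) β L δ) (.csub (.tsub (.csub M β L δ) x N) β L δ)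
  | appL : RedWXH M M' → RedWXH (.app M N) (.app M' N)
  | mu : RedWXH M M' → RedWXH (.mu α β M) (.mu α β M')
  | tsubL : RedWXH M M' → RedWXH (.tsub M x N) (.tsub M' x N)
  | csubL : RedWXH M M' → RedWXH (.csub M α N γ) (.csub M' α N γ)

def RedBMStar : Trm → Trm → Prop := Relation.ReflTransGen RedBM
def RedHStar : Trm → Trm → Prop := Relation.ReflTransGen RedH
def RedWHStar : Trm → Trm → Prop := Relation.ReflTransGen RedWH
def RedXStar : Trm → Trm → Prop := Relation.ReflTransGen RedX
def RedXSubStar : Trm → Trm → Prop := Relation.ReflTransGen RedXSub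
def RedXHStar : Trm → Trm → Prop := Relation.ReflTransGen RedXH
def RedWXHStar : Trm → Trm → Prop := Relation.ReflTransGen RedWXH

/-- a is a normal form for the reduction relation r -/
def Normal {α : Type _} (r : α → α → Prop) (a : α) : Prop := ∀ b, ¬ r a b

/-- an infinite r-reduction sequence starts at a -/
def Div {α : Type _} (r : α → α → Prop) (a : α) : Prop :=
  ∃ f : ℕ → α, f 0 = a ∧ ∀ n, r (f n) (f (n + 1))

/-- =βμ : the congruence generated by →βμ (which is contextually closed) -/
inductive EqBM : Trm → Trm → Prop
  | red : RedBM M N → EqBM M N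
  | refl : EqBM M M
  | symm : EqBM M N → EqBM N M
  | trans : EqBM M N → EqBM N L → EqBM M L

/-- =x : the congruence generated by →x -/
inductive EqX : Trm → Trm → Prop
  | red : RedX M N → EqX M N
  | refl : EqX M M
  | symm : EqX M N → EqX N M
  | trans : EqX M N → EqX N L → EqX M L

/-- applicative terms x M1 … Mn -/
inductive VApp : Trm → Prop
  | var : VApp (.var x)
  | app : VApp M → VApp (.app M N)

def notMu : Trm → Prop
  | .mu _ _ _ => False
  | _ => True

/-- head-normal forms of λμ -/
inductive HNF : Trm → Prop
  | lam : HNF M → HNF (.lam x M)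
  | head : VApp M → HNF M
  | mu : HNF H → (β ≠ α ∨ α ∈ fn H) → notMu H → HNF (.mu α β H)

/-- weak head-normal forms of λμ -/
inductive WHNF : Trm → Prop
  | lam : WHNF (.lam x M)
  | head : VApp M → WHNF M
  | mu : WHNF W → (β ≠ α ∨ α ∈ fn W) → notMu W → WHNF (.mu α β W)


/-! ## The synchronous π-calculus with pairing -/

inductive Dat : Type
  | name : ℕ → Dat
  | pair : ℕ → ℕ → Dat
  deriving DecidableEq

inductive Proc : Type
  | nil : Proc
  | par : Proc → Proc → Proc
  | repl : Proc → Proc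
  | nu : ℕ → Proc → Proc
  | inp : ℕ → ℕ → Proc → Proc          -- a(x).P
  | out : ℕ → Dat → Proc → Proc        -- ā⟨p⟩.P
  | letp : ℕ → ℕ → Dat → Proc → Proc   -- let ⟨x,y⟩ = p in P
  deriving DecidableEq

def Dat.ren (d : Dat) (o n : ℕ) : Dat :=
  match d with
  | .name a => .name (if a = o then n else a)
  | .pair a b => .pair (if a = o then n else a) (if b = o then n else b)

def Dat.fn : Dat → Finset ℕ
  | .name a => {a}
  | .pair a b => {a, b}

namespace Proc

def fn : Proc → Finset ℕ
  | .nil => ∅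
  | .par P Q => fn P ∪ fn Q
  | .repl P => fn P
  | .nu a P => fn P \ {a}
  | .inp a x P => insert a (fn P \ {x})
  | .out a d P => insert a (d.fn ∪ fn P)
  | .letp x y d P => d.fn ∪ (fn P \ {x, y})

/-- renaming of a free name in a process (capture-naive) -/
def ren : Proc → ℕ → ℕ → Proc
  | .nil, _, _ => .nil
  | .par P Q, o, n => .par (ren P o n) (ren Q o n)
  | .repl P, o, n => .repl (ren P o n)
  | .nu a P, o, n => if a = o then .nu a P else .nu a (ren P o n)
  | .inp a x P, o, n => .inp (if a = o then n else a) x (if x = o then P else ren P o n)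
  | .out a d P, o, n => .out (if a = o then n else a) (d.ren o n) (ren P o n)
  | .letp x y d P, o, n => .letp x y (d.ren o n) (if x = o ∨ y = o then P else ren P o n)

def Datpsub (d : Dat) (x a b : ℕ) : Dat :=
  match d with
  | .name c => if c = x then .pair a b else .name c
  | .pair c c' => .pair c c'

/-- substitution of a pair ⟨a,b⟩ for the name x (in data positions) -/
def psub : Proc → ℕ → ℕ → ℕ → Proc
  | .nil, _, _, _ => .nil
  | .par P Q, x, a, b => .par (psub P x a b) (psub Q x a b)
  | .repl P, x, a, b => .repl (psub P x a b)
  | .nu c P, x, a, b => if c = x then .nu c P else .nu c (psub P x a b)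
  | .inp c y P, x, a, b => .inp c y (if y = x then P else psub P x a b)
  | .out c d P, x, a, b => .out c (Datpsub d x a b) (psub P x a b)
  | .letp y z d P, x, a, b => .letp y z (Datpsub d x a b) (if y = x ∨ z = x then P else psub P x a b)

/-- substitution of a datum for a name:  P[d/x] -/
def subD (P : Proc) (x : ℕ) (d : Dat) : Proc :=
  match d with
  | .name a => P.ren x a
  | .pair a b => P.psub x a b

end Proc

/-- structural congruence -/
inductive SC : Proc → Proc → Prop
  | refl : SC P P
  | symm : SC P Q → SC Q P
  | trans : SC P Q → SC Q R → SC P R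
  | par_nil : SC (.par P .nil) P
  | par_comm : SC (.par P Q) (.par Q P)
  | par_assoc : SC (.par (.par P Q) R) (.par P (.par Q R))
  | repl : SC (.repl P) (.par P (.repl P))
  | nu_nil : SC (.nu n .nil) .nil
  | nu_swap : SC (.nu m (.nu n P)) (.nu n (.nu m P))
  | nu_par : n ∉ Proc.fn P → SC (.nu n (.par P Q)) (.par P (.nu n Q))
  | letp : SC (.letp x y (.pair a b) P) ((P.subD x (.name a)).subD y (.name b))
  | par_congr : SC P P' → SC Q Q' → SC (.par P Q) (.par P' Q')
  | repl_congr : SC P P' → SC (.repl P) (.repl P')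
  | nu_congr : SC P P' → SC (.nu n P) (.nu n P')
  | inp_congr : SC P P' → SC (.inp a x P) (.inp a x P')
  | out_congr : SC P P' → SC (.out a d P) (.out a d P')
  | letp_congr : SC P P' → SC (.letp x y d P) (.letp x y d P')

/-- →π: reduction of the π-calculus -/
inductive PiRed : Proc → Proc → Prop
  | comm : PiRed (.par (.out a d P) (.inp a x Q)) (.par P (Q.subD x d))
  | res : PiRed P P' → PiRed (.nu n P) (.nu n P')
  | parL : PiRed P P' → PiRed (.par P Q) (.par P' Q)
  | sc : SC P Q → PiRed Q Q' → SC Q' P' → PiRed P P'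

def PiRedStar : Proc → Proc → Prop := Relation.ReflTransGen PiRed

/-- P exhibits an output barb on n -/
inductive OutsOn : Proc → ℕ → Prop
  | out : OutsOn (.out n d P) n
  | parL : OutsOn P n → OutsOn (.par P Q) n
  | parR : OutsOn Q n → OutsOn (.par P Q) n
  | repl : OutsOn P n → OutsOn (.repl P) n
  | res : n ≠ m → OutsOn P n → OutsOn (.nu m P) n
  | sc : SC P Q → OutsOn Q n → OutsOn P n

/-- P exhibits an input barb on n -/
inductive InsOn : Proc → ℕ → Prop
  | inp : InsOn (.inp n x P) n
  | parL : InsOn P n → InsOn (.par P Q) n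
  | parR : InsOn Q n → InsOn (.par P Q) n
  | repl : InsOn P n → InsOn (.repl P) n
  | res : n ≠ m → InsOn P n → InsOn (.nu m P) n
  | sc : SC P Q → InsOn Q n → InsOn P n

def WOutsOn (P : Proc) (n : ℕ) : Prop := ∃ Q, PiRedStar P Q ∧ OutsOn Q n
def WInsOn (P : Proc) (n : ℕ) : Prop := ∃ Q, PiRedStar P Q ∧ InsOn Q n

/-- R is a barbed bisimulation -/
def BarbedRel (R : Proc → Proc → Prop) : Prop :=
  Symmetric R ∧ ∀ ⦃P Q⦄, R P Q →
    (∀ n, OutsOn P n → WOutsOn Q n) ∧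
    (∀ n, InsOn P n → WInsOn Q n) ∧
    (∀ P', PiRedStar P P' → ∃ Q', PiRedStar Q Q' ∧ R P' Q')

/-- barbed bisimilarity: the largest barbed bisimulation -/
def BBisim (P Q : Proc) : Prop := ∃ R, BarbedRel R ∧ R P Q

/-- process contexts -/
inductive PCtx : Type
  | hole : PCtx
  | parL : PCtx → Proc → PCtx
  | parR : Proc → PCtx → PCtx
  | repl : PCtx → PCtx
  | nu : ℕ → PCtx → PCtx
  | inp : ℕ → ℕ → PCtx → PCtx
  | out : ℕ → Dat → PCtx → PCtx
  | letp : ℕ → ℕ → Dat → PCtx → PCtx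

def PCtx.fill : PCtx → Proc → Proc
  | .hole, P => P
  | .parL C Q, P => .par (C.fill P) Q
  | .parR Q C, P => .par Q (C.fill P)
  | .repl C, P => .repl (C.fill P)
  | .nu n C, P => .nu n (C.fill P)
  | .inp a x C, P => .inp a x (C.fill P)
  | .out a d C, P => .out a d (C.fill P)
  | .letp x y d C, P => .letp x y d (C.fill P)

/-- weak bisimilarity ≈ : barbed bisimilarity in every context -/
def WBisim (P Q : Proc) : Prop := ∀ C : PCtx, BBisim (C.fill P) (C.fill Q)

/-! ## The logical interpretation of λμx into π -/

namespace Trm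

/-- all atoms (variables and names, free or bound) of a term -/
def an : Trm → Finset ℕ
  | var x => {x}
  | lam x M => insert x (an M)
  | app M N => an M ∪ an N
  | mu α β M => insert α (insert β (an M))
  | tsub M x N => insert x (an M ∪ an N)
  | csub M α N γ => insert α (insert γ (an M ∪ an N))
  | bot => ∅

end Trm

/-- a channel name fresh for M and a -/
def freshB (M : Trm) (a : ℕ) : ℕ := (insert a M.an).sup id + 1

/-- the logical, output-based interpretation ⟦M⟧a -/
def interp : Trm → ℕ → Proc
  | .var x, a =>
      -- ⟦x⟧a = x(u).!u(w).ā⟨w⟩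
      let u := freshB (.var x) a
      .inp x u (.repl (.inp u (u + 1) (.out a (.name (u + 1)) .nil)))
  | .lam x M, a =>
      -- ⟦λx.M⟧a = νx νb (⟦M⟧b | ā⟨x,b⟩)
      let b := freshB (.lam x M) a
      .nu x (.nu b (.par (interp M b) (.out a (.pair x b) .nil)))
  | .app M N, a =>
      -- ⟦MN⟧a = νc (⟦M⟧c | !c(v,d).(!νw(v̄⟨w⟩.⟦N⟧w) | !d(z).ā⟨z⟩))
      let f := freshB (.app M N) a
      .nu f (.par (interp M f)
        (.repl (.inp f (f + 1) (.letp (f + 2) (f + 3) (.name (f + 1))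
          (.par (.repl (.nu (f + 4) (.out (f + 2) (.name (f + 4)) (interp N (f + 4)))))
                (.repl (.inp (f + 3) (f + 5) (.out a (.name (f + 5)) .nil))))))))
  | .tsub M x N, a =>
      -- ⟦M⟨x:=N⟩⟧a = νx (⟦M⟧a | !νw(x̄⟨w⟩.⟦N⟧w))
      let w := freshB (.tsub M x N) a
      .nu x (.par (interp M a) (.repl (.nu w (.out x (.name w) (interp N w)))))
  | .mu γ β M, a =>
      -- ⟦μγ.[β]M⟧a = ⟦M[a/γ]⟧β
      interp (Trm.renN M γ a) (if β = γ then a else β)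
  | .csub M α N γ, a =>
      -- ⟦M⟨α:=N·γ⟩⟧a = να (⟦M⟧a | !α(v,d).(!νw(v̄⟨w⟩.⟦N⟧w) | !d(z).γ̄⟨z⟩))
      let f := freshB (.csub M α N γ) a
      .nu α (.par (interp M a)
        (.repl (.inp α (f + 1) (.letp (f + 2) (f + 3) (.name (f + 1))
          (.par (.repl (.nu (f + 4) (.out (f + 2) (.name (f + 4)) (interp N (f + 4)))))
                (.repl (.inp (f + 3) (f + 5) (.out γ (.name (f + 5)) .nil))))))))
  | .bot, _ => .nil
termination_by M _ => M.size
decreasing_by all_goals (simp only [Trm.size, Trm.size_renN]; omega)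

/-- ⟦M⟧a converges: it has a terminating →π-reduction sequence -/
def Converges (P : Proc) : Prop := ∃ Q, PiRedStar P Q ∧ Normal PiRed Q


/-! ## Simple types and context assignment -/

inductive Ty : Type
  | base : ℕ → Ty
  | arr : Ty → Ty → Ty
  deriving DecidableEq

abbrev Ctx : Type := ℕ → Option Ty

def Ctx.cons (Γ : Ctx) (x : ℕ) (A : Ty) : Ctx := fun y => if y = x then some A else Γ y

def Ctx.le (Γ Γ' : Ctx) : Prop := ∀ x A, Γ x = some A → Γ' x = some A

/-- simple type assignment for λμx:  Γ ⊢ M : A | Δ -/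
inductive LmuxTy : Ctx → Trm → Ty → Ctx → Prop
  | ax {Γ Δ : Ctx} {x : ℕ} {A : Ty} : Γ x = some A → LmuxTy Γ (.var x) A Δ
  | arrI {Γ Δ : Ctx} {x : ℕ} {A B : Ty} {M : Trm} :
      LmuxTy (Ctx.cons Γ x A) M B Δ → LmuxTy Γ (.lam x M) (.arr A B) Δ
  | arrE {Γ Δ : Ctx} {A B : Ty} {M N : Trm} :
      LmuxTy Γ M (.arr A B) Δ → LmuxTy Γ N A Δ → LmuxTy Γ (.app M N) B Δ
  | mu1 {Γ Δ : Ctx} {α β : ℕ} {A B : Ty} {M : Trm} :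
      LmuxTy Γ M B (Ctx.cons (Ctx.cons Δ β B) α A) →
      LmuxTy Γ (.mu α β M) A (Ctx.cons Δ β B)
  | mu2 {Γ Δ : Ctx} {α : ℕ} {A : Ty} {M : Trm} :
      LmuxTy Γ M A (Ctx.cons Δ α A) → LmuxTy Γ (.mu α α M) A Δ
  | tcut {Γ Δ : Ctx} {x : ℕ} {A B : Ty} {M N : Trm} :
      LmuxTy (Ctx.cons Γ x A) M B Δ → LmuxTy Γ N A Δ → LmuxTy Γ (.tsub M x N) B Δ
  | ccut {Γ Δ : Ctx} {α γ : ℕ} {A B C : Ty} {M N : Trm} :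
      LmuxTy Γ M C (Ctx.cons Δ α (.arr A B)) → LmuxTy Γ N A Δ →
      LmuxTy Γ (.csub M α N γ) C (Ctx.cons Δ γ B)

/-- functional context assignment for the π-calculus:  P : Γ ⊢π Δ -/
inductive PiTy : Proc → Ctx → Ctx → Prop
  | nil {Γ Δ : Ctx} : PiTy .nil Γ Δ
  | par {Γ Δ : Ctx} {P Q : Proc} : PiTy P Γ Δ → PiTy Q Γ Δ → PiTy (.par P Q) Γ Δ
  | repl {Γ Δ : Ctx} {P : Proc} : PiTy P Γ Δ → PiTy (.repl P) Γ Δ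
  | nu {Γ Δ : Ctx} {a : ℕ} {A : Ty} {P : Proc} :
      PiTy P (Ctx.cons Γ a A) (Ctx.cons Δ a A) → PiTy (.nu a P) Γ Δ
  | inp {Γ Δ : Ctx} {a x : ℕ} {A : Ty} {P : Proc} :
      PiTy P (Ctx.cons Γ x A) (Ctx.cons Δ x A) → PiTy (.inp a x P) (Ctx.cons Γ a A) Δ
  | out {Γ Δ : Ctx} {a b : ℕ} {A : Ty} {P : Proc} : a ≠ b →
      PiTy P (Ctx.cons Γ b A) (Ctx.cons Δ b A) →
      PiTy (.out a (.name b) P) (Ctx.cons Γ b A) (Ctx.cons (Ctx.cons Δ a A) b A)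
  | pout {Γ Δ : Ctx} {a b c : ℕ} {A B : Ty} {P : Proc} :
      Γ a = none → Γ c = none → Δ a = none →
      PiTy P (Ctx.cons Γ b A) (Ctx.cons Δ c B) →
      PiTy (.out a (.pair b c) P) (Ctx.cons Γ b A) (Ctx.cons (Ctx.cons Δ c B) a (.arr A B))
  | letp {Γ Δ : Ctx} {x y z : ℕ} {A B : Ty} {P : Proc} :
      Δ y = none → Δ z = none → Γ x = none →
      PiTy P (Ctx.cons Γ y B) (Ctx.cons Δ x A) →
      PiTy (.letp x y (.name z) P) (Ctx.cons Γ z (.arr A B)) Δ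
  | weak {Γ Γ' Δ Δ' : Ctx} {P : Proc} :
      Ctx.le Γ Γ' → Ctx.le Δ Δ' → PiTy P Γ Δ → PiTy P Γ' Δ'

/-! ## Weak approximation -/

mutual
  /-- heads of weak approximants:  x A1 … An -/
  inductive WApprHead : Trm → Prop
    | var : WApprHead (.var x)
    | app : WApprHead A → WAppr B → WApprHead (.app A B)

  /-- weak approximants -/
  inductive WAppr : Trm → Prop
    | bot : WAppr .bot
    | lam : WAppr A → WAppr (.lam x A)
    | head : WApprHead A → WAppr A
    | mu : WAppr A → (β ≠ α ∨ α ∈ Trm.fn A) → notMu A → A ≠ .bot → WAppr (.mu α β A)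
end

/-- ⊑ : the smallest preorder that is the compatible extension of ⊥ ⊑ M -/
inductive Sqs : Trm → Trm → Prop
  | bot : Sqs .bot M
  | refl : Sqs M M
  | trans : Sqs A B → Sqs B C → Sqs A C
  | lam : Sqs A M → Sqs (.lam x A) (.lam x M)
  | app : Sqs A M → Sqs B N → Sqs (.app A B) (.app M N)
  | mu : Sqs A M → Sqs (.mu α β A) (.mu α β M)

/-- 𝒜(M): the set of weak approximants of M -/
def ASet (M : Trm) : Set Trm :=
  { A | WAppr A ∧ ∃ N, RedBMStar M N ∧ Sqs A N }

/-! ## Weak equivalences -/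

/-- M has a weak head-normal form -/
def HasWHNF (M : Trm) : Prop := ∃ W, RedBMStar M W ∧ WHNF W

/-- ≡wβμ : the smallest congruence equating weak βμ-convertible terms
    and all terms without WHNF -/
inductive EquivWBM : Trm → Trm → Prop
  | nowhnf : ¬ HasWHNF M → ¬ HasWHNF N → EquivWBM M N
  | beta : EquivWBM (.app (.lam x M) N) (subst M x N)
  | mu_main : γ ∉ fn M → γ ∉ fn N → γ ≠ α → γ ≠ β →
      EquivWBM (.app (.mu α β M) N) (muApp α β M N γ)
  | ren : EquivWBM (.mu δ β (.mu γ α M)) (.mu δ (if α = γ then β else α) (renN M γ β))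
  | erase : α ∉ fn M → EquivWBM (.mu α α M) M
  | refl : EquivWBM M M
  | symm : EquivWBM M N → EquivWBM N M
  | trans : EquivWBM M N → EquivWBM N L → EquivWBM M L
  | lam_congr : EquivWBM M N → EquivWBM (.lam x M) (.lam x N)
  | app_congr : EquivWBM M M' → EquivWBM N N' → EquivWBM (.app M N) (.app M' N')
  | mu_congr : EquivWBM M N → EquivWBM (.mu α β M) (.mu α β N)

/-- x M1 … Mn -/
def mkApp (h : Trm) (l : List Trm) : Trm := l.foldl .app h

/-- M weak-head reduces to some →wh-normal form -/
def HasWhNf (M : Trm) : Prop := ∃ W, RedWHStar M W ∧ Normal RedWH W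

def WhMatch (R : Trm → Trm → Prop) (M' N' : Trm) : Prop :=
  (∃ x Ms Ns, M' = mkApp (.var x) Ms ∧ N' = mkApp (.var x) Ns ∧ List.Forall₂ R Ms Ns) ∨
  (∃ x M'' N'', M' = .lam x M'' ∧ N' = .lam x N'' ∧ R M'' N'') ∨
  (∃ α β M'' N'', M' = .mu α β M'' ∧ N' = .mu α β N'' ∧ R M'' N'')

def WhBisimRel (R : Trm → Trm → Prop) : Prop :=
  Symmetric R ∧ ∀ ⦃M N⦄, R M N →
    (¬ HasWhNf M ∧ ¬ HasWhNf N) ∨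
    ∃ M' N', RedWHStar M M' ∧ Normal RedWH M' ∧ RedWHStar N N' ∧ Normal RedWH N' ∧
      WhMatch R M' N'

/-- ≡wh : weak head equivalence (coinductively, the largest such relation) -/
def EquivWH (M N : Trm) : Prop := ∃ R, WhBisimRel R ∧ R M N

/-- outstanding explicit substitutions -/
inductive ESub : Type
  | t : ℕ → Trm → ESub        -- ⟨x:=N⟩
  | c : ℕ → Trm → ℕ → ESub    -- ⟨α:=N·γ⟩

/-- M·S : a term with a list of outstanding explicit substitutions -/
def applySubs : Trm → List ESub → Trm
  | M, [] => M
  | M, (ESub.t x N) :: S => applySubs (.tsub M x N) S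
  | M, (ESub.c α N γ) :: S => applySubs (.csub M α N γ) S

def ESub.bindsVar : ESub → ℕ → Prop
  | .t x _, y => x = y
  | .c _ _ _, _ => False

def ESub.bindsName : ESub → ℕ → Prop
  | .t _ _, _ => False
  | .c α _ _, β => α = β

def bindsVar (S : List ESub) (x : ℕ) : Prop := ∃ s ∈ S, ESub.bindsVar s x
def bindsName (S : List ESub) (β : ℕ) : Prop := ∃ s ∈ S, ESub.bindsName s β

/-- M reduces by →wxh to some →wxh-normal form -/
def HasWxhNf (M : Trm) : Prop := ∃ W, RedWXHStar M W ∧ Normal RedWXH W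

def WxhMatch (R : Trm → Trm → Prop) (S S' : List ESub) (M' N' : Trm) : Prop :=
  (∃ x Ms Ns, M' = mkApp (.var x) Ms ∧ N' = mkApp (.var x) Ns ∧
      ¬ bindsVar S x ∧ ¬ bindsVar S' x ∧
      List.Forall₂ (fun P Q => R (applySubs P S) (applySubs Q S')) Ms Ns) ∨
  (∃ x M'' N'', M' = .lam x M'' ∧ N' = .lam x N'' ∧
      R (applySubs M'' S) (applySubs N'' S')) ∨
  (∃ α β M'' N'', M' = .mu α β M'' ∧ N' = .mu α β N'' ∧
      ¬ bindsName S β ∧ ¬ bindsName S' β ∧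
      R (applySubs M'' S) (applySubs N'' S'))

def WxhBisimRel (R : Trm → Trm → Prop) : Prop :=
  Symmetric R ∧ ∀ ⦃M N⦄, R M N →
    (¬ HasWxhNf M ∧ ¬ HasWxhNf N) ∨
    ∃ M' S N' S', RedWXHStar M (applySubs M' S) ∧ Normal RedWXH (applySubs M' S) ∧
      RedWXHStar N (applySubs N' S') ∧ Normal RedWXH (applySubs N' S') ∧
      WxhMatch R S S' M' N'

/-- ≡wxh : weak explicit head equivalence (coinductively, the largest such relation) -/
def EquivWXH (M N : Trm) : Prop := ∃ R, WxhBisimRel R ∧ R M N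

/-! ## Explicit substitutions evaluate to implicit ones -/

namespace RedXSubStar

theorem appL {M M' N : Trm} (h : RedXSubStar M M') : RedXSubStar (.app M N) (.app M' N) :=
  Relation.ReflTransGen.lift (fun t => Trm.app t N) (fun _ _ => RedXSub.appL) _ _ h

theorem appR {M N N' : Trm} (h : RedXSubStar N N') : RedXSubStar (.app M N) (.app M N') :=
  Relation.ReflTransGen.lift (fun t => Trm.app M t) (fun _ _ => RedXSub.appR) _ _ h

theorem app {M M' N N' : Trm} (h : RedXSubStar M M') (h' : RedXSubStar N N') :
    RedXSubStar (.app M N) (.app M' N') :=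
  h.appL.trans h'.appR

theorem lam {M M' : Trm} {x : ℕ} (h : RedXSubStar M M') :
    RedXSubStar (.lam x M) (.lam x M') :=
  Relation.ReflTransGen.lift (fun t => Trm.lam x t) (fun _ _ => RedXSub.lam) _ _ h

theorem mu {M M' : Trm} {α β : ℕ} (h : RedXSubStar M M') :
    RedXSubStar (.mu α β M) (.mu α β M') :=
  Relation.ReflTransGen.lift (fun t => Trm.mu α β t) (fun _ _ => RedXSub.mu) _ _ h

end RedXSubStar

theorem RedXSub.redX {M N : Trm} (h : RedXSub M N) : RedX M N := by
  induction h with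
  | tvar => exact .tvar
  | tgc h => exact .tgc h
  | tlam h => exact .tlam h
  | tapp => exact .tapp
  | tmu => exact .tmu
  | cmu h => exact .cmu h
  | cmu' h h' => exact .cmu' h h'
  | cgc h => exact .cgc h
  | clam => exact .clam
  | capp => exact .capp
  | appL _ ih => exact .appL ih
  | appR _ ih => exact .appR ih
  | lam _ ih => exact .lam ih
  | mu _ ih => exact .mu ih
  | tsubL _ ih => exact .tsubL ih
  | tsubR _ ih => exact .tsubR ih
  | csubL _ ih => exact .csubL ih
  | csubR _ ih => exact .csubR ih

theorem RedXSubStar.redXStar {M N : Trm} (h : RedXSubStar M N) : RedXStar M N :=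
  Relation.ReflTransGen.mono (fun _ _ => RedXSub.redX) _ _ h

theorem Pure.tsub_redXSubStar {M : Trm} (hM : Pure M) (x : ℕ) (N : Trm) :
    RedXSubStar (.tsub M x N) (subst M x N) := by
  induction hM with
  | @var y =>
    by_cases h : y = x
    · subst h
      simpa [RedXSubStar, Trm.subst] using Relation.ReflTransGen.single RedXSub.tvar
    · simpa [RedXSubStar, Trm.subst, h] using
        Relation.ReflTransGen.single (RedXSub.tgc (M := .var y) (by simpa [fv] using Ne.symm h))
  | @lam M y _ ih =>
    by_cases h : y = x
    · subst h
      simpa [RedXSubStar, Trm.subst] using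
        Relation.ReflTransGen.single (RedXSub.tgc (M := .lam y M) (by simp [fv]))
    · simpa [RedXSubStar, Trm.subst, h] using Relation.ReflTransGen.head (RedXSub.tlam h) ih.lam
  | app _ _ ih ih' => exact Relation.ReflTransGen.head .tapp (ih.app ih')
  | mu _ ih => exact Relation.ReflTransGen.head .tmu ih.mu

theorem Pure.csub_redXSubStar {M : Trm} (hM : Pure M) (α : ℕ) (N : Trm) (γ : ℕ) :
    RedXSubStar (.csub M α N γ) (ssub M α N γ) := by
  induction hM with
  | var => exact Relation.ReflTransGen.single (.cgc (by simp [fn]))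
  | lam _ ih => exact Relation.ReflTransGen.head .clam ih.lam
  | app _ _ ih ih' => exact Relation.ReflTransGen.head .capp (ih.app ih')
  | @mu M δ β _ ih =>
    by_cases h : δ = α
    · subst h
      simpa [RedXSubStar, ssub] using
        Relation.ReflTransGen.single (RedXSub.cgc (M := .mu δ β M) (by simp [fn]))
    · by_cases h' : β = α
      · subst h'
        simpa [RedXSubStar, ssub, h] using Relation.ReflTransGen.head (RedXSub.cmu h) ih.appL.mu
      · simpa [RedXSubStar, ssub, h, h'] using Relation.ReflTransGen.head (RedXSub.cmu' h h') ih.mu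

theorem Pure.muX_redXSubStar {M : Trm} (hM : Pure M) (α β γ : ℕ) (N : Trm) :
    RedXSubStar (muX α β γ M N) (muApp α β M N γ) := by
  unfold muX muApp
  split_ifs
  · exact (hM.csub_redXSubStar α N γ).appL.mu
  · exact (hM.csub_redXSubStar α N γ).mu

/-! ## Purity is preserved by the implicit operations -/

theorem Pure.subst {M N : Trm} (hM : Pure M) (hN : Pure N) (x : ℕ) :
    Pure (Trm.subst M x N) := by
  induction hM with
  | var => unfold Trm.subst; split_ifs; exacts [hN, .var]
  | lam h ih => unfold Trm.subst; split_ifs; exacts [h.lam, ih.lam]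
  | app _ _ ih ih' => exact ih.app ih'
  | mu _ ih => exact ih.mu

theorem Pure.renN {M : Trm} (hM : Pure M) (o n : ℕ) : Pure (Trm.renN M o n) := by
  induction hM with
  | var => exact .var
  | lam _ ih => exact ih.lam
  | app _ _ ih ih' => exact ih.app ih'
  | mu h ih => unfold Trm.renN; split_ifs <;> first | exact h.mu | exact ih.mu

theorem Pure.ssub {M N : Trm} (hM : Pure M) (hN : Pure N) (α γ : ℕ) :
    Pure (Trm.ssub M α N γ) := by
  induction hM with
  | var => exact .var
  | lam _ ih => exact ih.lam
  | app _ _ ih ih' => exact ih.app ih'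
  | mu h ih => unfold Trm.ssub; split_ifs; exacts [h.mu, (ih.app hN).mu, ih.mu]

theorem Pure.muApp {M N : Trm} (hM : Pure M) (hN : Pure N) (α β γ : ℕ) :
    Pure (muApp α β M N γ) := by
  unfold PiLMu.muApp
  split_ifs
  exacts [((hM.ssub hN α γ).app hN).mu, (hM.ssub hN α γ).mu]

/-! ## Simulation -/

theorem RedBM.redXStar {M N : Trm} (hM : Pure M) (h : RedBM M N) : RedXStar M N := by
  induction h with
  | beta =>
    cases hM with
    | app h _ =>
      cases h with
      | lam h => exact .head .beta (h.tsub_redXSubStar _ _).redXStar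
  | mu_main h₁ h₂ h₃ h₄ =>
    cases hM with
    | app h _ =>
      cases h with
      | mu h => exact .head (.mu_main h₁ h₂ h₃ h₄) (h.muX_redXSubStar _ _ _ _).redXStar
  | ren => exact .single .ren
  | erase h => exact .single (.erase h)
  | appL _ ih =>
    cases hM with
    | app h _ => exact .lift (Trm.app · _) (fun _ _ => RedX.appL) _ _ (ih h)
  | appR _ ih =>
    cases hM with
    | app _ h => exact .lift (Trm.app _) (fun _ _ => RedX.appR) _ _ (ih h)
  | lam _ ih =>
    cases hM with
    | lam h => exact .lift (Trm.lam _) (fun _ _ => RedX.lam) _ _ (ih h)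
  | mu _ ih =>
    cases hM with
    | mu h => exact .lift (Trm.mu _ _) (fun _ _ => RedX.mu) _ _ (ih h)

theorem RedX.exists_pure_redXSubStar {M N : Trm} (hM : Pure M) (h : RedX M N) :
    ∃ L : Trm, Pure L ∧ RedXSubStar N L := by
  induction h with
  | beta =>
    cases hM with
    | app h hN =>
      cases h with
      | lam h => exact ⟨_, h.subst hN _, h.tsub_redXSubStar _ _⟩
  | mu_main =>
    cases hM with
    | app h hN =>
      cases h with
      | mu h => exact ⟨_, h.muApp hN _ _ _, h.muX_redXSubStar _ _ _ _⟩
  | erase =>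
    cases hM with
    | mu h => exact ⟨_, h, .refl⟩
  | ren =>
    cases hM with
    | mu h =>
      cases h with
      | mu h => exact ⟨_, (h.renN _ _).mu, .refl⟩
  | appL _ ih =>
    cases hM with
    | app h hN =>
      obtain ⟨L, hL, hr⟩ := ih h
      exact ⟨_, hL.app hN, hr.appL⟩
  | appR _ ih =>
    cases hM with
    | app h hN =>
      obtain ⟨L, hL, hr⟩ := ih hN
      exact ⟨_, h.app hL, hr.appR⟩
  | lam _ ih =>
    cases hM with
    | lam h =>
      obtain ⟨L, hL, hr⟩ := ih h
      exact ⟨_, hL.lam, hr.lam⟩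
  | mu _ ih =>
    cases hM with
    | mu h =>
      obtain ⟨L, hL, hr⟩ := ih h
      exact ⟨_, hL.mu, hr.mu⟩
  | _ => cases hM

/-- λμx implements λμ-reduction. -/
theorem lmux_implements_lmu :
    (∀ M N : Trm, Pure M → RedBM M N → RedXStar M N) ∧
    (∀ M N : Trm, Pure M → RedX M N → ∃ L : Trm, Pure L ∧ RedXSubStar N L) :=
  ⟨fun _ _ => RedBM.redXStar, fun _ _ => RedX.exists_pure_redXSubStar⟩

end PiLMu
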